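/- On the board Rhombus(6), the c3-complement problem (vacancy at c3 = (2,2), final peg at c3) has a solution consisting of 13 moves, and no solution consisting of fewer than 13 moves. -/

import Mathlib

/-- The six jump directions on the triangular lattice (oblique coordinates). -/
def Dirs : Finset (ℤ × ℤ) := {(1,0), (-1,0), (0,1), (0,-1), (1,1), (-1,-1)}

/-- The rhombus board of side `n`: `{0,…,n−1} × {0,…,n−1}`. -/
noncomputable def Rhombus (n : ℕ) : Finset (ℤ × ℤ) :=
  Finset.Icc (0 : ℤ) ((n : ℤ) - 1) ×ˢ Finset.Icc (0 : ℤ) ((n : ℤ) - 1)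

/-- A jump in position `P` on board `B`: peg at `p`, direction `d ∈ Dirs`,
peg at `p+d`, empty board hole at `p+2d`. -/
def JumpOK (B P : Finset (ℤ × ℤ)) (p d : ℤ × ℤ) : Prop :=
  d ∈ Dirs ∧ p ∈ P ∧ p + d ∈ P ∧ p + d + d ∈ B ∧ p + d + d ∉ P

/-- The position resulting from the jump `(p, d)` in position `P`. -/
def jumpResult (P : Finset (ℤ × ℤ)) (p d : ℤ × ℤ) : Finset (ℤ × ℤ) :=
  (P \ {p, p + d}) ∪ {p + d + d}

/-- `SweepFrom B P s ds e Q`: starting in position `P`, the peg at `s` makes the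
consecutive jumps with directions `ds` (each jump starting where the previous landed),
ending at hole `e` and producing position `Q`.  A move is such a sweep with `ds ≠ []`;
its length (number of pegs captured) is `ds.length`. -/
inductive SweepFrom (B : Finset (ℤ × ℤ)) :
    Finset (ℤ × ℤ) → ℤ × ℤ → List (ℤ × ℤ) → ℤ × ℤ → Finset (ℤ × ℤ) → Prop
  | nil (P : Finset (ℤ × ℤ)) (s : ℤ × ℤ) : SweepFrom B P s [] s P
  | cons {P : Finset (ℤ × ℤ)} {s d e : ℤ × ℤ} {ds : List (ℤ × ℤ)} {Q : Finset (ℤ × ℤ)} :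
      JumpOK B P s d → SweepFrom B (jumpResult P s d) (s + d + d) ds e Q →
      SweepFrom B P s (d :: ds) e Q

/-- A move is recorded as a pair (starting hole, nonempty list of jump directions).
`PlayMove B P m Q` says the move `m` is legal in position `P` and produces `Q`. -/
def PlayMove (B P : Finset (ℤ × ℤ)) (m : (ℤ × ℤ) × List (ℤ × ℤ))
    (Q : Finset (ℤ × ℤ)) : Prop :=
  m.2 ≠ [] ∧ ∃ e, SweepFrom B P m.1 m.2 e Q

/-- `Plays B P ms Q`: the finite sequence of moves `ms` leads from position `P`
to position `Q` on board `B`. -/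
inductive Plays (B : Finset (ℤ × ℤ)) :
    Finset (ℤ × ℤ) → List ((ℤ × ℤ) × List (ℤ × ℤ)) → Finset (ℤ × ℤ) → Prop
  | nil (P : Finset (ℤ × ℤ)) : Plays B P [] P
  | cons {P Q R : Finset (ℤ × ℤ)} {m : (ℤ × ℤ) × List (ℤ × ℤ)}
      {ms : List ((ℤ × ℤ) × List (ℤ × ℤ))} :
      PlayMove B P m Q → Plays B Q ms R → Plays B P (m :: ms) R

/-- The list of all holes touched by a sweep starting at `s` with directions `ds`:
every starting hole, every jumped-over hole and every landing hole. -/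
def sweepHoles (s : ℤ × ℤ) : List (ℤ × ℤ) → List (ℤ × ℤ)
  | [] => [s]
  | d :: ds => s :: (s + d) :: sweepHoles (s + d + d) ds

/-- The hole where a sweep starting at `s` with directions `ds` ends. -/
def sweepEnd (s : ℤ × ℤ) : List (ℤ × ℤ) → ℤ × ℤ
  | [] => s
  | d :: ds => sweepEnd (s + d + d) ds

/-- A single jump as a step relation between positions on board `B`. -/
def JumpStep (B P Q : Finset (ℤ × ℤ)) : Prop :=
  ∃ p d, JumpOK B P p d ∧ Q = jumpResult P p d

/-- The position after a sweep, if every jump of the sweep is legal. -/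
def runSweep (B : Finset (ℤ × ℤ)) :
    Finset (ℤ × ℤ) → ℤ × ℤ → List (ℤ × ℤ) → Option (Finset (ℤ × ℤ))
  | P, _, [] => some P
  | P, s, d :: ds =>
    if d ∈ Dirs ∧ s ∈ P ∧ s + d ∈ P ∧ s + d + d ∈ B ∧ s + d + d ∉ P then
      runSweep B (jumpResult P s d) (s + d + d) ds
    else none

/-- The position after a sequence of moves, if every move is legal. -/
def runMoves (B : Finset (ℤ × ℤ)) :
    Finset (ℤ × ℤ) → List ((ℤ × ℤ) × List (ℤ × ℤ)) → Option (Finset (ℤ × ℤ))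
  | P, [] => some P
  | P, m :: ms =>
    if m.2 = [] then none else (runSweep B P m.1 m.2).bind fun Q => runMoves B Q ms

theorem exists_sweepFrom_of_runSweep {B : Finset (ℤ × ℤ)} (ds : List (ℤ × ℤ)) :
    ∀ {P Q : Finset (ℤ × ℤ)} {s : ℤ × ℤ}, runSweep B P s ds = some Q →
      ∃ e, SweepFrom B P s ds e Q := by
  induction ds with
  | nil =>
    intro P Q s h
    obtain rfl : P = Q := by simpa [runSweep] using h
    exact ⟨s, .nil P s⟩
  | cons d ds ih =>
    intro P Q s h
    rw [runSweep] at h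
    split_ifs at h with hj
    obtain ⟨e, he⟩ := ih h
    exact ⟨e, .cons hj he⟩

theorem plays_of_runMoves {B : Finset (ℤ × ℤ)} (ms : List ((ℤ × ℤ) × List (ℤ × ℤ))) :
    ∀ {P Q : Finset (ℤ × ℤ)}, runMoves B P ms = some Q → Plays B P ms Q := by
  induction ms with
  | nil =>
    intro P Q h
    obtain rfl : P = Q := by simpa [runMoves] using h
    exact .nil P
  | cons m ms ih =>
    intro P Q h
    rw [runMoves] at h
    split_ifs at h with hm
    obtain ⟨R, hR, hQ⟩ := Option.bind_eq_some_iff.1 h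
    exact .cons ⟨hm, exists_sweepFrom_of_runSweep _ hR⟩ (ih hQ)

/-- A Merson region: while it is full of pegs, no peg outside it can jump over one of its
pegs. -/
def IsMersonRegion (B R : Finset (ℤ × ℤ)) : Prop :=
  ∀ x ∈ R, ∀ d ∈ Dirs, x - d ∈ R ∨ x + d ∈ R ∨ x - d ∉ B ∨ x + d ∉ B

instance (B R : Finset (ℤ × ℤ)) : Decidable (IsMersonRegion B R) := by
  unfold IsMersonRegion; infer_instance

theorem jumpResult_subset_board {B P : Finset (ℤ × ℤ)} {s d : ℤ × ℤ} (hP : P ⊆ B)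
    (h : JumpOK B P s d) : jumpResult P s d ⊆ B := by
  intro x hx
  simp only [jumpResult, Finset.mem_union, Finset.mem_sdiff, Finset.mem_singleton] at hx
  rcases hx with hx | rfl
  · exact hP hx.1
  · exact h.2.2.2.1

theorem SweepFrom.subset_board {B P Q : Finset (ℤ × ℤ)} {s e : ℤ × ℤ} {ds : List (ℤ × ℤ)}
    (h : SweepFrom B P s ds e Q) (hP : P ⊆ B) : Q ⊆ B := by
  induction h with
  | nil => exact hP
  | cons hj _ ih => exact ih (jumpResult_subset_board hP hj)

theorem IsMersonRegion.subset_jumpResult {B R P : Finset (ℤ × ℤ)} {s d : ℤ × ℤ}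
    (hR : IsMersonRegion B R) (hP : P ⊆ B) (hRP : R ⊆ P) (hs : s ∉ R)
    (hj : JumpOK B P s d) : R ⊆ jumpResult P s d := by
  obtain ⟨hd, hsP, _, hlB, hlP⟩ := hj
  have hmid : s + d ∉ R := by
    intro hmem
    rcases hR _ hmem d hd with h | h | h | h
    · exact hs (by simpa using h)
    · exact hlP (hRP h)
    · exact h (by simpa using hP hsP)
    · exact h hlB
  intro x hx
  have hxs : x ≠ s := fun h => hs (h ▸ hx)
  have hxm : x ≠ s + d := fun h => hmid (h ▸ hx)
  simp [jumpResult, hRP hx, hxs, hxm]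

/-- A sweep starting outside a full Merson region leaves that region full. -/
theorem IsMersonRegion.subset_of_sweepFrom {B R P Q : Finset (ℤ × ℤ)} {s e : ℤ × ℤ}
    {ds : List (ℤ × ℤ)} (hR : IsMersonRegion B R) (h : SweepFrom B P s ds e Q) (hP : P ⊆ B)
    (hRP : R ⊆ P) (hs : s ∉ R) : R ⊆ Q := by
  induction h with
  | nil => exact hRP
  | cons hj _ ih =>
    exact ih (jumpResult_subset_board hP hj) (hR.subset_jumpResult hP hRP hs hj)
      fun h => hj.2.2.2.2 (hRP h)

/-- Emptying a family of disjoint full Merson regions takes at least one move per region. -/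
theorem Plays.card_mersonRegions_le {B P Q : Finset (ℤ × ℤ)}
    {ms : List ((ℤ × ℤ) × List (ℤ × ℤ))} (h : Plays B P ms Q) (hP : P ⊆ B)
    (F : Finset (Finset (ℤ × ℤ))) (hF : ∀ R ∈ F, IsMersonRegion B R)
    (hdisj : ∀ R ∈ F, ∀ S ∈ F, R ≠ S → Disjoint R S)
    (hFP : ∀ R ∈ F, R ⊆ P) (hFQ : ∀ R ∈ F, ¬R ⊆ Q) : F.card ≤ ms.length := by
  induction h generalizing F with
  | nil =>
    rw [Finset.eq_empty_of_forall_notMem fun R hR => hFQ R hR (hFP R hR)]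
    simp
  | @cons P P' Q m ms hm _ ih =>
    obtain ⟨_, e, hsw⟩ := hm
    have hP' := hsw.subset_board hP
    have hrest := ih hP' (F.filter (m.1 ∉ ·)) (fun R hR => hF R (Finset.mem_filter.1 hR).1)
      (fun R hR S hS => hdisj R (Finset.mem_filter.1 hR).1 S (Finset.mem_filter.1 hS).1)
      (fun R hR => (hF R (Finset.mem_filter.1 hR).1).subset_of_sweepFrom hsw hP
        (hFP R (Finset.mem_filter.1 hR).1) (Finset.mem_filter.1 hR).2)
      (fun R hR => hFQ R (Finset.mem_filter.1 hR).1)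
    have hone : (F.filter (m.1 ∈ ·)).card ≤ 1 := by
      refine Finset.card_le_one.2 fun R hR S hS => ?_
      rw [Finset.mem_filter] at hR hS
      by_contra hne
      exact Finset.disjoint_left.1 (hdisj R hR.1 S hS.1 hne) hR.2 hS.2
    have hsplit := Finset.card_filter_add_card_filter_not (s := F) (m.1 ∈ ·)
    rw [List.length_cons]
    omega

/-- Twelve disjoint Merson regions on the border of `Rhombus 6`: the four corners and two
pairs of adjacent holes on each edge. -/
def borderRegions : Finset (Finset (ℤ × ℤ)) :=
  {{(0, 0)}, {(5, 0)}, {(0, 5)}, {(5, 5)},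
   {(1, 0), (2, 0)}, {(3, 0), (4, 0)}, {(1, 5), (2, 5)}, {(3, 5), (4, 5)},
   {(0, 1), (0, 2)}, {(0, 3), (0, 4)}, {(5, 1), (5, 2)}, {(5, 3), (5, 4)}}

/-- The hexagonal Merson region of `Rhombus 6` centred at `(3, 3)`. -/
def hexRegion : Finset (ℤ × ℤ) :=
  {(3, 3), (4, 3), (2, 3), (3, 4), (3, 2), (4, 4), (2, 2)}

theorem isMersonRegion_of_mem :
    ∀ R ∈ insert hexRegion borderRegions, IsMersonRegion (Rhombus 6) R := by
  decide +kernel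

theorem disjoint_of_mem_regions :
    ∀ R ∈ insert hexRegion borderRegions, ∀ S ∈ insert hexRegion borderRegions,
      R ≠ S → Disjoint R S := by
  decide +kernel

theorem not_subset_singleton_of_mem_regions :
    ∀ R ∈ insert hexRegion borderRegions, ¬R ⊆ {((2 : ℤ), (2 : ℤ))} := by
  decide +kernel

/-- The regions that are full after the first jump still number at least twelve. -/
theorem twelve_le_card_regions_after_jump :
    ∀ d ∈ Dirs, 12 ≤ ((insert hexRegion borderRegions).filter
      (· ⊆ jumpResult ((Rhombus 6).erase (2, 2)) ((2, 2) - d - d) d)).card := by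
  decide +kernel

/-- The first move consists of a single jump. -/
theorem no_second_jump :
    ∀ d ∈ Dirs, ∀ d' ∈ Dirs,
      ¬((2, 2) + d' ∈ jumpResult ((Rhombus 6).erase (2, 2)) ((2, 2) - d - d) d ∧
        (2, 2) + d' + d' ∈ Rhombus 6 ∧
        (2, 2) + d' + d' ∉ jumpResult ((Rhombus 6).erase (2, 2)) ((2, 2) - d - d) d) := by
  decide +kernel

/-- A first move from the `c3`-vacancy position is a single jump into `c3`. -/
theorem exists_eq_jumpResult_of_playMove {m : (ℤ × ℤ) × List (ℤ × ℤ)} {Q : Finset (ℤ × ℤ)}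
    (h : PlayMove (Rhombus 6) ((Rhombus 6).erase (2, 2)) m Q) :
    ∃ d ∈ Dirs, Q = jumpResult ((Rhombus 6).erase (2, 2)) ((2, 2) - d - d) d := by
  obtain ⟨hne, e, hsw⟩ := h
  obtain ⟨s, ds⟩ := m
  cases hsw with
  | nil => exact absurd rfl hne
  | @cons _ _ d _ _ _ hj hrest =>
    have hland : s + d + d = (2, 2) := by
      by_contra hcon
      exact hj.2.2.2.2 (Finset.mem_erase.2 ⟨hcon, hj.2.2.2.1⟩)
    obtain rfl : s = (2, 2) - d - d := by rw [← hland]; abel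
    refine ⟨d, hj.1, ?_⟩
    rw [hland] at hrest
    cases hrest with
    | nil => rfl
    | cons hj' _ => exact absurd hj'.2.2 (no_second_jump d hj.1 _ hj'.1)

/-- On `Rhombus 6`, the c3-complement problem (c3 = (2,2)) has a solution
of 13 moves, and no solution of fewer than 13 moves. -/
theorem rhombus6_c3_complement_min_13_moves :
    (∃ ms : List ((ℤ × ℤ) × List (ℤ × ℤ)),
      Plays (Rhombus 6) ((Rhombus 6).erase ((2 : ℤ), (2 : ℤ))) ms
        {((2 : ℤ), (2 : ℤ))} ∧ ms.length = 13) ∧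
    (∀ ms : List ((ℤ × ℤ) × List (ℤ × ℤ)),
      Plays (Rhombus 6) ((Rhombus 6).erase ((2 : ℤ), (2 : ℤ))) ms
        {((2 : ℤ), (2 : ℤ))} → 13 ≤ ms.length) := by
  constructor
  · exact ⟨
  [((0, 2), [(1, 0)]),
   ((3, 2), [(-1, 0)]),
   ((0, 4), [(0, -1), (1, 0)]),
   ((2, 5), [(-1, -1)]),
   ((5, 4), [(-1, -1), (-1, 0), (0, 1)]),
   ((4, 5), [(0, -1)]),
   ((0, 0), [(1, 1), (1, 1)]),
   ((5, 2), [(0, 1)]),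
   ((0, 5), [(1, 0), (1, 0)]),
   ((5, 0), [(0, 1)]),
   ((5, 5), [(-1, -1), (-1, 0), (1, 1), (1, 0), (0, -1), (0, -1)]),
   ((3, 0), [(0, 1), (1, 0), (0, -1), (-1, 0)]),
   ((2, 0), [(-1, 0), (0, 1), (0, 1), (1, 0), (1, 0), (0, -1), (0, -1), (-1, 0), (0, 1)])],
      plays_of_runMoves _ (by decide +kernel), rfl⟩
  · intro ms h
    generalize hT : ({((2 : ℤ), (2 : ℤ))} : Finset (ℤ × ℤ)) = T at h
    cases h with
    | nil => exact absurd hT (by decide +kernel)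
    | cons hm hms =>
      obtain ⟨d, hd, rfl⟩ := exists_eq_jumpResult_of_playMove hm
      obtain ⟨_, _, hsw⟩ := hm
      have hmem {R : Finset (ℤ × ℤ)} (hR : R ∈ (insert hexRegion borderRegions).filter
          (· ⊆ jumpResult ((Rhombus 6).erase (2, 2)) ((2, 2) - d - d) d)) :=
        Finset.mem_filter.1 hR
      have hcard := hms.card_mersonRegions_le (hsw.subset_board (Finset.erase_subset _ _)) _
        (fun R hR => isMersonRegion_of_mem R (hmem hR).1)
        (fun R hR S hS => disjoint_of_mem_regions R (hmem hR).1 S (hmem hS).1)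
        (fun R hR => (hmem hR).2)
        (fun R hR => hT ▸ not_subset_singleton_of_mem_regions R (hmem hR).1)
      have htwelve := twelve_le_card_regions_after_jump d hd
      rw [List.length_cons]
      omega
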